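/- Let r, m be positive integers, p, q real numbers, and A the matrix on V = Fin r × Fin m with A (u,a) (v,b) = p if u = v and q otherwise. Then for every integer l ≥ 1 and all vertices i, j ∈ V lying in the same cluster, the entry of A^l satisfies (A^l)_{ij} = m^{l−1}·( (p + (r − 1)·q)^l + (r − 1)·(p − q)^l ) / r. -/

import Mathlib

/-- Product rule for block-constant kernels of the form "constant plus multiple of the
same-block indicator". -/
theorem sum_block_mul_block {r m : ℕ} (c d c' d' : ℝ) (u v : Fin r) :
    ∑ k : Fin r × Fin m,
        (c + if u = k.1 then d else 0) * (c' + if k.1 = v then d' else 0)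
      = m * (r * c * c' + c * d' + d * c' + if u = v then d * d' else 0) := by
  simp only [Fintype.sum_prod_type]
  simp only [add_mul, mul_add, Finset.sum_add_distrib, Finset.sum_const, Finset.card_univ,
    Fintype.card_fin, nsmul_eq_mul, mul_ite, ite_mul, mul_zero, zero_mul,
    Finset.sum_ite_eq, Finset.sum_ite_eq', Finset.mem_univ, if_true]
  split_ifs <;> ring

/-- All entries of the positive powers of the planted partition matrix. -/
theorem plantedPartition_pow_succ_apply {r m : ℕ} (hr : 0 < r) (p q : ℝ)
    (A : Matrix (Fin r × Fin m) (Fin r × Fin m) ℝ)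
    (hA : ∀ u v : Fin r × Fin m, A u v = if u.1 = v.1 then p else q)
    (n : ℕ) (i j : Fin r × Fin m) :
    (A ^ (n + 1)) i j
      = (m : ℝ) ^ n * ((((p + ((r : ℝ) - 1) * q) ^ (n + 1) - (p - q) ^ (n + 1)) / r)
          + if i.1 = j.1 then (p - q) ^ (n + 1) else 0) := by
  have hr' : (r : ℝ) ≠ 0 := by positivity
  induction n generalizing j with
  | zero =>
    rw [zero_add, pow_one, hA]
    split_ifs <;> field_simp <;> ring
  | succ n ih =>
    have hA' (k : Fin r × Fin m) : A k j = q + if k.1 = j.1 then p - q else 0 := by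
      rw [hA]
      split_ifs <;> ring
    rw [pow_succ A (n + 1), Matrix.mul_apply]
    simp only [ih, hA', mul_assoc]
    rw [← Finset.mul_sum, sum_block_mul_block]
    split_ifs <;> field_simp <;> ring

theorem stmt6 (r m : ℕ) (hr : 0 < r) (hm : 0 < m) (p q : ℝ)
    (A : Matrix (Fin r × Fin m) (Fin r × Fin m) ℝ)
    (hA : ∀ u v : Fin r × Fin m, A u v = if u.1 = v.1 then p else q)
    (l : ℕ) (hl : 1 ≤ l)
    (i j : Fin r × Fin m) (hij : i.1 = j.1) :
    (A ^ l) i j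
      = (m : ℝ) ^ (l - 1) *
          ((p + ((r : ℝ) - 1) * q) ^ l + ((r : ℝ) - 1) * (p - q) ^ l) / (r : ℝ) := by
  obtain ⟨n, rfl⟩ := Nat.exists_eq_add_of_le' hl
  have hr' : (r : ℝ) ≠ 0 := by positivity
  rw [plantedPartition_pow_succ_apply hr p q A hA, if_pos hij, Nat.add_sub_cancel]
  field_simp
  ring
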